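/- arXiv:1208.0308 — 8 statements merged into one kernel-verified Lean document; each statement's English description precedes it below -/
import Mathlib

section
/- Let b be a rational number with b(1 + b) ≠ 0 and set c = 0. Then D(b,0) = 2b(1 + b) ≠ 0, K(b,0) = 4b² ≠ 0, and for all rational x and d the identities 2(1 + b)²·P(x) = x·(2(1 + b)²x² + 2b(1 + b)x − (1 + 2b)) and 2(1 + b)²·Q(d) = (d + 1)·(2(1 + b)²d² − 2b(1 + b)d − (1 + 2b)) hold; in particular both cubic polynomials P and Q are reducible over ℚ. -/
noncomputable section

/-- The common denominator `D(b,c)`. -/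
def Dd (b c : ℚ) : ℚ := b^2*c^2 + 2*b^2 - 3*b^2*c + c - b*c^2 + 2*b

/-- The quantity `K(b,c)`. -/
def Kk (b c : ℚ) : ℚ := b^2*c^4 - 6*b^2*c^3 + 13*b^2*c^2 - 12*b^2*c + 4*b^2 + c^2

def E10 (b c : ℚ) : ℚ := -(b^2*c^2 + 2*b^2 - 3*b^2*c - c) / Dd b c

def E20 (b c : ℚ) : ℚ :=
  (b/2)*(b*c^2 - 2*c - 2*b)*(2*b*c^2 - c^2 - 6*b*c + 2 + 4*b) / (Dd b c)^2

def E30 (b c : ℚ) : ℚ :=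
  b^2*c*(1 - c)*(c - 2)*(b*c^2 - 4*b*c + 2 + 4*b)*(2*b*c^2 - c^2 - 4*b*c + 2*b)
    / (Kk b c * (Dd b c)^2)

def E01 (b c : ℚ) : ℚ := -(b*(c^2 + 2 - 2*c)) / Dd b c

def E02 (b c : ℚ) : ℚ :=
  (1/2)*(28*b^2*c^2 - 16*b^2*c - 2*c^2 - 4*b^2 - b^2*c^4 + 4*b^3*c^4 - 12*b^3*c^3
    + 4*b*c^3 + 24*b^3*c - 8*b*c - 2*b^4*c^4 + 12*b^4*c^3 - 26*b^4*c^2 - 8*b^2*c^3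
    + 24*b^4*c - 16*b^3 - 8*b^4) / (Dd b c)^2

def E03 (b c : ℚ) : ℚ :=
  (b/2)*(b^2*c^4 - 5*b^2*c^3 + 10*b^2*c^2 - 10*b^2*c + 4*b^2 + 2*b*c + 2*c^2 - b*c^3)
    *(2*b^2*c^4 - 12*b^2*c^3 + 26*b^2*c^2 - 24*b^2*c + 8*b^2 - b*c^4 + 3*b*c^3
      - 6*b*c + 4*b + c^3 - 2*c^2 + 2*c) / (Kk b c * (Dd b c)^2)

/-- The first cubic polynomial, evaluated at `x`. -/
def P (b c x : ℚ) : ℚ := x^3 - E10 b c * x^2 + E20 b c * x - E30 b c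

/-- The second cubic polynomial, evaluated at `d`. -/
def Q (b c d : ℚ) : ℚ := d^3 - E01 b c * d^2 + E02 b c * d - E03 b c

open Polynomial in
/-- The first cubic as a polynomial over `ℚ`. -/
def Ppoly (b c : ℚ) : Polynomial ℚ :=
  X^3 - C (E10 b c) * X^2 + C (E20 b c) * X - C (E30 b c)

open Polynomial in
/-- The second cubic as a polynomial over `ℚ`. -/
def Qpoly (b c : ℚ) : Polynomial ℚ :=
  X^3 - C (E01 b c) * X^2 + C (E02 b c) * X - C (E03 b c)

/-- The rational perfect cuboid equations with unit space diagonal. -/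
def CuboidEqs (x1 x2 x3 d1 d2 d3 : ℚ) : Prop :=
  x1^2 + x2^2 + x3^2 = 1 ∧ x2^2 + x3^2 = d1^2 ∧ x3^2 + x1^2 = d2^2 ∧ x1^2 + x2^2 = d3^2

/-- The auxiliary equations with prescribed right-hand sides `E21`, `E11`, `E12`. -/
def AuxEqs (x1 x2 x3 d1 d2 d3 E21 E11 E12 : ℚ) : Prop :=
  x1*x2*d3 + x2*x3*d1 + x3*x1*d2 = E21 ∧
  x1*d2 + d1*x2 + x2*d3 + d2*x3 + x3*d1 + d3*x1 = E11 ∧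
  x1*d2*d3 + x2*d3*d1 + x3*d1*d2 = E12

open Polynomial in
/-- A monic cubic over a field with a root is not irreducible. -/
theorem not_irreducible_cubic_of_root {F : Type*} [Field F] {a₁ a₂ a₃ r : F}
    (hr : r^3 - a₁ * r^2 + a₂ * r - a₃ = 0) :
    ¬ Irreducible (X^3 - C a₁ * X^2 + C a₂ * X - C a₃ : F[X]) := by
  intro h
  have h_one := degree_eq_one_of_irreducible_of_root h (x := r) (by simpa [IsRoot] using hr)
  have h_three : (X^3 - C a₁ * X^2 + C a₂ * X - C a₃ : F[X]).degree = 3 := by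
    compute_degree!
  rw [h_three] at h_one
  exact absurd h_one (by decide)

/-- The second reducibility case `c = 0`. -/
theorem stmt1 (b : ℚ) (hb : b * (1 + b) ≠ 0) :
    Dd b 0 = 2 * b * (1 + b) ∧ Dd b 0 ≠ 0 ∧ Kk b 0 = 4 * b^2 ∧ Kk b 0 ≠ 0 ∧
    (∀ x : ℚ, 2 * (1 + b)^2 * P b 0 x
      = x * (2 * (1 + b)^2 * x^2 + 2 * b * (1 + b) * x - (1 + 2 * b))) ∧
    (∀ d : ℚ, 2 * (1 + b)^2 * Q b 0 d
      = (d + 1) * (2 * (1 + b)^2 * d^2 - 2 * b * (1 + b) * d - (1 + 2 * b))) ∧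
    ¬ Irreducible (Ppoly b 0) ∧ ¬ Irreducible (Qpoly b 0) := by
  obtain ⟨hb0, hb1⟩ := mul_ne_zero_iff.mp hb
  have hD : Dd b 0 = 2 * b * (1 + b) := by simp only [Dd]; ring
  have hK : Kk b 0 = 4 * b^2 := by simp only [Kk]; ring
  have hP (x : ℚ) : 2 * (1 + b)^2 * P b 0 x
      = x * (2 * (1 + b)^2 * x^2 + 2 * b * (1 + b) * x - (1 + 2 * b)) := by
    simp only [P, E10, E20, E30, hD, hK]
    field_simp
    ring
  have hQ (d : ℚ) : 2 * (1 + b)^2 * Q b 0 d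
      = (d + 1) * (2 * (1 + b)^2 * d^2 - 2 * b * (1 + b) * d - (1 + 2 * b)) := by
    simp only [Q, E01, E02, E03, hD, hK]
    field_simp
    ring
  have h_two : 2 * (1 + b)^2 ≠ 0 := by positivity
  refine ⟨hD, ?_, hK, ?_, hP, hQ, ?_, ?_⟩
  · rw [hD]; positivity
  · rw [hK]; positivity
  · refine not_irreducible_cubic_of_root (r := 0) ((mul_eq_zero_iff_left h_two).mp ?_)
    exact (hP 0).trans (by ring)
  · refine not_irreducible_cubic_of_root (r := -1) ((mul_eq_zero_iff_left h_two).mp ?_)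
    exact (hQ (-1)).trans (by ring)

end
end

section
/- If b and β are rational numbers satisfying b² + 4b + 2 = β², then there exists a nonzero rational number t such that b = (t² − 4t + 2)/(2t) and β = (t² − 2)/(2t). Conversely, for every nonzero rational t, the numbers b = (t² − 4t + 2)/(2t) and β = (t² − 2)/(2t) satisfy b² + 4b + 2 = β². -/
noncomputable section

/-- Rational solutions of `b² + 4b + 2 = β²` are parameterized by a nonzero rational `t`. -/
theorem stmt2 :
    (∀ b β : ℚ, b^2 + 4*b + 2 = β^2 →
      ∃ t : ℚ, t ≠ 0 ∧ b = (t^2 - 4*t + 2)/(2*t) ∧ β = (t^2 - 2)/(2*t)) ∧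
    (∀ t : ℚ, t ≠ 0 →
      ((t^2 - 4*t + 2)/(2*t))^2 + 4*((t^2 - 4*t + 2)/(2*t)) + 2
        = ((t^2 - 2)/(2*t))^2) := by
  refine ⟨fun b β h => ?_, fun t ht => by field_simp; ring⟩
  have hmul : (b + 2 + β) * (b + 2 - β) = 2 := by linear_combination h
  have ht : b + 2 + β ≠ 0 := left_ne_zero_of_mul (hmul.trans_ne two_ne_zero)
  refine ⟨b + 2 + β, ht, ?_, ?_⟩
  · rw [eq_div_iff (mul_ne_zero two_ne_zero ht)]
    linear_combination hmul
  · rw [eq_div_iff (mul_ne_zero two_ne_zero ht)]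
    linear_combination -hmul

end
end

section
/- For every rational number t one has (t − 2)² − 2 ≠ 0. If b and β are rational numbers satisfying 2b² + 4b + 1 = β², then there exist a rational number t and a sign ε ∈ {1, −1} such that b = 2t/((t − 2)² − 2) and β = ε(t² − 2)/((t − 2)² − 2). Conversely, for every rational t and either sign ε, these formulas give a rational solution of 2b² + 4b + 1 = β². -/
noncomputable section

/-- The denominator of the parameterization never vanishes, as `2` is not a rational square. -/
theorem sub_two_sq_sub_two_ne_zero (t : ℚ) : (t - 2)^2 - 2 ≠ 0 := by
  intro h
  refine (irrational_iff_ne_rational _).1 irrational_sqrt_two |t - 2|.num |t - 2|.den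
    (by exact_mod_cast |t - 2|.den_nz) ?_
  have h2 : ((t - 2 : ℚ) : ℝ)^2 = 2 := by exact_mod_cast sub_eq_zero.1 h
  rw [← h2, Real.sqrt_sq_eq_abs, ← Rat.cast_abs, Rat.cast_def]
  simp

/-- Rational solutions of `2b² + 4b + 1 = β²` are parameterized by a rational `t`
and a sign. -/
theorem stmt5 :
    (∀ t : ℚ, (t - 2)^2 - 2 ≠ 0) ∧
    (∀ b β : ℚ, 2*b^2 + 4*b + 1 = β^2 →
      ∃ t ε : ℚ, (ε = 1 ∨ ε = -1) ∧
        b = 2*t/((t - 2)^2 - 2) ∧ β = ε*(t^2 - 2)/((t - 2)^2 - 2)) ∧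
    (∀ t ε : ℚ, (ε = 1 ∨ ε = -1) →
      2*(2*t/((t - 2)^2 - 2))^2 + 4*(2*t/((t - 2)^2 - 2)) + 1
        = (ε*(t^2 - 2)/((t - 2)^2 - 2))^2) := by
  refine ⟨sub_two_sq_sub_two_ne_zero, fun b β h => ?_, fun t ε hε => ?_⟩
  · rcases eq_or_ne b 0 with rfl | hb
    · refine ⟨0, -β, ?_, by norm_num, by ring⟩
      have hβ : β^2 = 1 := by linarith
      rcases eq_or_eq_neg_of_sq_eq_sq β 1 (by simpa using hβ) with rfl | rfl <;> simp
    · -- Project from the point `(0, 1)`: the line through `(b, β)` has slope `m = 2 - t`.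
      obtain ⟨m, hm⟩ : ∃ m : ℚ, m * b = β - 1 := ⟨(β - 1) / b, div_mul_cancel₀ _ hb⟩
      have hD := sub_two_sq_sub_two_ne_zero (2 - m)
      have hb_eq : b * ((2 - m - 2)^2 - 2) = 2 * (2 - m) := by
        apply mul_left_cancel₀ hb
        linear_combination (m * b + β + 1) * hm - h
      refine ⟨2 - m, -1, Or.inr rfl, (eq_div_iff hD).2 hb_eq, (eq_div_iff hD).2 ?_⟩
      linear_combination m * hb_eq - ((2 - m - 2)^2 - 2) * hm
  · have hD := sub_two_sq_sub_two_ne_zero t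
    have hε2 : ε^2 = 1 := by rcases hε with rfl | rfl <;> norm_num
    rw [div_pow (ε * _), mul_pow, hε2]
    field_simp
    ring

end
end

section
/- Let t be a rational number, set b = 2t/((t − 2)² − 2) (the denominator is nonzero for all rational t), and define x₁ = 0, x₂ = t(t − 2)/((t − 1)² + 1), x₃ = −2(t − 1)/((t − 1)² + 1), d₁ = −1, d₂ = −2(t − 1)/((t − 1)² + 1), d₃ = t(t − 2)/((t − 1)² + 1). Then x₂ and x₃ are roots of the quadratic 2(1 + b)²X² − (2b + 2)X − b(b + 2), d₂ and d₃ are roots of the same quadratic, and (x₁, x₂, x₃, d₁, d₂, d₃) satisfy the rational perfect cuboid equations with unit space diagonal and the auxiliary equations with right-hand sides E21 = 2t(t² − 3t + 2)/((t − 1)² + 1)², E11 = 2t/((t − 1)² + 1), E12 = −1. -/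
noncomputable section

/-- The quadratic of the case `c = 1` vanishes at `x` as soon as its two Vieta data, the sum
`x + y` of the roots and `x ^ 2 + y ^ 2 = 1`, are known. -/
theorem quadratic_eq_zero_of_vieta {b x y : ℚ} (hsum : (1 + b) * (x + y) = 1)
    (hsq : x^2 + y^2 = 1) : 2*(1 + b)^2*x^2 - (2*b + 2)*x - b*(b + 2) = 0 := by
  linear_combination (2 * (1 + b) * x - (1 + b) * (x + y) - 1) * hsum + (1 + b)^2 * hsq

/-- The rational roots in the third reducibility case `c = 1`. -/
theorem stmt6 (t b x1 x2 x3 d1 d2 d3 : ℚ)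
    (hb : b = 2*t/((t - 2)^2 - 2))
    (hx1 : x1 = 0) (hx2 : x2 = t*(t - 2)/((t - 1)^2 + 1))
    (hx3 : x3 = -2*(t - 1)/((t - 1)^2 + 1))
    (hd1 : d1 = -1) (hd2 : d2 = -2*(t - 1)/((t - 1)^2 + 1))
    (hd3 : d3 = t*(t - 2)/((t - 1)^2 + 1)) :
    (t - 2)^2 - 2 ≠ 0 ∧
    2*(1 + b)^2*x2^2 - (2*b + 2)*x2 - b*(b + 2) = 0 ∧
    2*(1 + b)^2*x3^2 - (2*b + 2)*x3 - b*(b + 2) = 0 ∧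
    2*(1 + b)^2*d2^2 - (2*b + 2)*d2 - b*(b + 2) = 0 ∧
    2*(1 + b)^2*d3^2 - (2*b + 2)*d3 - b*(b + 2) = 0 ∧
    CuboidEqs x1 x2 x3 d1 d2 d3 ∧
    AuxEqs x1 x2 x3 d1 d2 d3
      (2*t*(t^2 - 3*t + 2)/((t - 1)^2 + 1)^2) (2*t/((t - 1)^2 + 1)) (-1) := by
  have hn := sub_two_sq_sub_two_ne_zero t
  have hm : (t - 1)^2 + 1 ≠ 0 := by positivity
  have hsum : (1 + b) * (x2 + x3) = 1 := by
    rw [hb, hx2, hx3]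
    field_simp
    ring
  have hsq : x2^2 + x3^2 = 1 := by
    rw [hx2, hx3]
    field_simp
    ring
  have h2 := quadratic_eq_zero_of_vieta hsum hsq
  have h3 := quadratic_eq_zero_of_vieta (add_comm x2 x3 ▸ hsum) (add_comm (x2^2) _ ▸ hsq)
  have hd2' : d2 = x3 := hd2.trans hx3.symm
  have hd3' : d3 = x2 := hd3.trans hx2.symm
  have hE21 : -(x2 * x3) = 2*t*(t^2 - 3*t + 2)/((t - 1)^2 + 1)^2 := by
    rw [hx2, hx3]
    field_simp
    ring
  have hE11 : 1 - (x2 + x3) = 2*t/((t - 1)^2 + 1) := by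
    rw [hx2, hx3]
    field_simp
    ring
  clear hx2 hx3 hd2 hd3
  subst hx1 hd1 hd2' hd3'
  refine ⟨hn, h2, h3, h3, h2, ⟨?_, ?_, ?_, ?_⟩, ?_, ?_, ?_⟩
  · linear_combination hsq
  · linear_combination hsq
  · ring
  · ring
  · linear_combination hE21
  · linear_combination hE11 + hsq
  · linear_combination -hsq

end
end

section
/- For every rational number t one has (t + 2)² − 2 ≠ 0. If b and β are rational numbers satisfying 2b² − 4b + 1 = β², then there exist a rational number t and a sign ε ∈ {1, −1} such that b = 2t/((t + 2)² − 2) and β = ε(t² − 2)/((t + 2)² − 2). Conversely, for every rational t and either sign ε, these formulas give a rational solution of 2b² − 4b + 1 = β². -/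
noncomputable section

/-- The denominator `(t + 2)^2 - 2` has no rational zero, since `2` is not a rational square. -/
theorem add_two_sq_sub_two_ne_zero (t : ℚ) : (t + 2)^2 - 2 ≠ 0 := fun h =>
  irrational_sqrt_two.ne_rat |t + 2| <| by
    have h2 : ((t + 2 : ℚ) : ℝ)^2 = 2 := by exact_mod_cast sub_eq_zero.mp h
    rw [← h2, Real.sqrt_sq_eq_abs, Rat.cast_abs]

/-- Rational solutions of `2b² − 4b + 1 = β²` are parameterized by a rational `t`
and a sign. -/
theorem stmt8 :
    (∀ t : ℚ, (t + 2)^2 - 2 ≠ 0) ∧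
    (∀ b β : ℚ, 2*b^2 - 4*b + 1 = β^2 →
      ∃ t ε : ℚ, (ε = 1 ∨ ε = -1) ∧
        b = 2*t/((t + 2)^2 - 2) ∧ β = ε*(t^2 - 2)/((t + 2)^2 - 2)) ∧
    (∀ t ε : ℚ, (ε = 1 ∨ ε = -1) →
      2*(2*t/((t + 2)^2 - 2))^2 - 4*(2*t/((t + 2)^2 - 2)) + 1
        = (ε*(t^2 - 2)/((t + 2)^2 - 2))^2) := by
  refine ⟨add_two_sq_sub_two_ne_zero, fun b β h => ?_, fun t ε hε => ?_⟩
  · rcases eq_or_ne b 0 with rfl | hb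
    · have hβ : β = 1 ∨ β = -1 := by
        simpa using sq_eq_sq_iff_eq_or_eq_neg.mp (show β^2 = 1^2 by linarith)
      exact ⟨0, -β, by rcases hβ with rfl | rfl <;> simp, by norm_num, by ring⟩
    · have hD := add_two_sq_sub_two_ne_zero ((1 - 2*b + β)/b)
      refine ⟨(1 - 2*b + β)/b, 1, Or.inl rfl, ?_, ?_⟩
      · rw [eq_div_iff hD]
        field_simp
        linear_combination -h
      · rw [eq_div_iff hD]
        field_simp
        linear_combination (-1 - β) * h
  · have hD := add_two_sq_sub_two_ne_zero t
    have hε2 : ε^2 = 1 := by rcases hε with rfl | rfl <;> norm_num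
    field_simp
    rw [hε2]
    ring

end
end

section
/- Let t be a rational number, set b = 2t/((t + 2)² − 2) (the denominator is nonzero for all rational t), and define x₁ = 0, x₂ = 2(t + 1)/((t + 1)² + 1), x₃ = t(t + 2)/((t + 1)² + 1), d₁ = 1, d₂ = −t(t + 2)/((t + 1)² + 1), d₃ = −2(t + 1)/((t + 1)² + 1). Then x₂ and x₃ are roots of the quadratic 2(b − 1)²X² + 2(b − 1)X − b(b − 2), d₂ and d₃ are roots of the quadratic 2(b − 1)²X² − 2(b − 1)X − b(b − 2), and (x₁, x₂, x₃, d₁, d₂, d₃) satisfy the rational perfect cuboid equations with unit space diagonal and the auxiliary equations with right-hand sides E21 = 2t(t² + 3t + 2)/((t + 1)² + 1)², E11 = 2t/((t + 1)² + 1), E12 = −1. -/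
noncomputable section

/-- No rational number squares to two. -/
theorem rat_sq_ne_two (q : ℚ) : q^2 ≠ 2 := by
  intro h
  have h_real : (q : ℝ)^2 = 2 := by exact_mod_cast h
  refine irrational_sqrt_two ⟨|q|, ?_⟩
  rw [Rat.cast_abs, ← Real.sqrt_sq_eq_abs, h_real]

/-- The rational roots in the fourth reducibility case `c = 2`. -/
theorem stmt9 (t b x1 x2 x3 d1 d2 d3 : ℚ)
    (hb : b = 2*t/((t + 2)^2 - 2))
    (hx1 : x1 = 0) (hx2 : x2 = 2*(t + 1)/((t + 1)^2 + 1))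
    (hx3 : x3 = t*(t + 2)/((t + 1)^2 + 1))
    (hd1 : d1 = 1) (hd2 : d2 = -t*(t + 2)/((t + 1)^2 + 1))
    (hd3 : d3 = -2*(t + 1)/((t + 1)^2 + 1)) :
    (t + 2)^2 - 2 ≠ 0 ∧
    2*(b - 1)^2*x2^2 + 2*(b - 1)*x2 - b*(b - 2) = 0 ∧
    2*(b - 1)^2*x3^2 + 2*(b - 1)*x3 - b*(b - 2) = 0 ∧
    2*(b - 1)^2*d2^2 - 2*(b - 1)*d2 - b*(b - 2) = 0 ∧
    2*(b - 1)^2*d3^2 - 2*(b - 1)*d3 - b*(b - 2) = 0 ∧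
    CuboidEqs x1 x2 x3 d1 d2 d3 ∧
    AuxEqs x1 x2 x3 d1 d2 d3
      (2*t*(t^2 + 3*t + 2)/((t + 1)^2 + 1)^2) (2*t/((t + 1)^2 + 1)) (-1) := by
  have hN : (t + 2)^2 - 2 ≠ 0 := sub_ne_zero.mpr (rat_sq_ne_two (t + 2))
  have hS : (t + 1)^2 + 1 ≠ 0 := by positivity
  subst hb hx1 hx2 hx3 hd1 hd2 hd3
  refine ⟨hN, ?_, ?_, ?_, ?_, ⟨?_, ?_, ?_, ?_⟩, ?_, ?_, ?_⟩ <;> field_simp <;> ring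

end
end

section
/- Let b and c be rational numbers with D(b,c) ≠ 0 and K(b,c) ≠ 0. Then the value of the second cubic polynomial at d = −1 is Q(−1) = −b²c²(c − 1)²(bc² − 4bc + 4b + 2)²/(K·D²). -/
noncomputable section

/-- The value of the second cubic polynomial at `d = -1`. -/
theorem stmt10 (b c : ℚ) (hD : Dd b c ≠ 0) (hK : Kk b c ≠ 0) :
    Q b c (-1)
      = -(b^2*c^2*(c - 1)^2*(b*c^2 - 4*b*c + 4*b + 2)^2) / (Kk b c * (Dd b c)^2) := by
  unfold Q E01 E02 E03
  field_simp
  unfold Dd Kk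
  ring

end
end

section
/- Let b and c be rational numbers with D(b,c) ≠ 0 and K(b,c) ≠ 0, and suppose 2bc² − 4bc + 2b − c² = 0. Then E30 = 0, so that x = 0 is a root of the first cubic polynomial P, and Q(1) = 0, so that d = 1 is a root of the second cubic polynomial Q; in particular both P and Q are reducible over ℚ. -/
noncomputable section

open Polynomial in
theorem natDegree_monic_cubic (p q r : ℚ) :
    (X^3 - C p * X^2 + C q * X - C r : ℚ[X]).natDegree = 3 := by
  compute_degree!

/-- The sixth reducibility condition `2bc² − 4bc + 2b − c² = 0`. -/
theorem stmt13 (b c : ℚ) (hD : Dd b c ≠ 0) (hK : Kk b c ≠ 0)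
    (h : 2*b*c^2 - 4*b*c + 2*b - c^2 = 0) :
    E30 b c = 0 ∧ P b c 0 = 0 ∧ Q b c 1 = 0 ∧
    ¬ Irreducible (Ppoly b c) ∧ ¬ Irreducible (Qpoly b c) := by
  have hx : E30 b c = 0 := by
    have : 2*b*c^2 - c^2 - 4*b*c + 2*b = 0 := by linear_combination h
    simp [E30, this]
  have hP : P b c 0 = 0 := by simp [P, hx]
  have hQ : Q b c 1 = 0 := by
    have hc : c - 1 ≠ 0 := by
      intro hc
      obtain rfl : c = 1 := by linarith
      norm_num at h
      linarith
    have hb : b = c^2 / (2*(c - 1)^2) := by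
      field_simp
      linear_combination h
    have clear_denoms {D K : ℚ} (hD : D ≠ 0) (hK : K ≠ 0) (p q r : ℚ)
        (e : D^2*K - p*D*K + q*K - r = 0) :
        1^3 - p/D*1^2 + q/D^2*1 - r/(K*D^2) = 0 := by
      field_simp
      linear_combination e
    refine clear_denoms hD hK _ _ _ ?_
    rw [Dd, Kk, hb]
    field_simp
    ring
  refine ⟨hx, hP, hQ, fun hi => ?_, fun hi => ?_⟩
  · exact hi.not_isRoot_of_natDegree_ne_one
      (by rw [Ppoly, natDegree_monic_cubic]; norm_num)
      (x := 0) (by simpa [Polynomial.IsRoot, Ppoly, P] using hP)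
  · exact hi.not_isRoot_of_natDegree_ne_one
      (by rw [Qpoly, natDegree_monic_cubic]; norm_num)
      (x := 1) (by simpa [Polynomial.IsRoot, Qpoly, Q] using hQ)

end
end
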